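/- Let x, y, z be rational numbers, not all zero, satisfying (x + y + z)·y³ = (x² − x·z + z²)·(x·z − y²). Then y = 0 and x·z = 0. Equivalently, the only rational points of the smooth plane quartic C : (x + y + z)y³ = (x² − xz + z²)(xz − y²) in ℙ²_ℚ are the two points (1 : 0 : 0) and (0 : 0 : 1). -/

import Mathlib

lemma sq_mod_eight_odd {k : ℤ} (hk : k % 2 = 1) : k ^ 2 % 8 = 1 := by
  have h : k % 8 = 1 ∨ k % 8 = 3 ∨ k % 8 = 5 ∨ k % 8 = 7 := by omega
  rcases h with h | h | h | h <;> rw [pow_two, Int.mul_emod, h] <;> rfl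

lemma pos_sq_of_coprime {p q c : ℤ} (hp : 0 < p) (h : IsCoprime p q) (e : p * q = c ^ 2) :
    ∃ a, p = a ^ 2 := by
  obtain ⟨a, ha | ha⟩ := Int.sq_of_isCoprime h e
  · exact ⟨a, ha⟩
  · exfalso
    nlinarith [sq_nonneg a]

/-- The infinite descent: the system `ab = 4mn`, `a² - b² = m² - n²`. -/
lemma descent (k : ℕ) : ∀ a b m n : ℤ, a.natAbs = k → a % 2 = 0 → IsCoprime a b → IsCoprime m n →
    a * b = 4 * (m * n) → a ^ 2 - b ^ 2 = m ^ 2 - n ^ 2 → a = 0 := by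
  induction k using Nat.strong_induction_on with
  | _ N ih =>
  intro a b m n hN ha hab hmn h1 h2
  by_contra ha0
  have hbodd : b % 2 = 1 := by
    rcases Int.emod_two_eq_zero_or_one b with hb | hb
    · exfalso
      obtain ⟨u, v, huv⟩ := hab
      obtain ⟨a', rfl⟩ := Int.dvd_of_emod_eq_zero ha
      obtain ⟨b', rfl⟩ := Int.dvd_of_emod_eq_zero hb
      have : 2 * (u * a' + v * b') = 1 := by linarith
      omega
    · exact hb
  have h4b : IsCoprime (4 : ℤ) b := by
    have h2b : IsCoprime (2 : ℤ) b := by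
      refine ⟨-(b / 2), 1, ?_⟩
      omega
    have := h2b.mul_left h2b
    norm_num at this
    exact this
  obtain ⟨a', rfl⟩ : (4 : ℤ) ∣ a := h4b.dvd_of_dvd_mul_right ⟨m * n, h1⟩
  have ha'0 : a' ≠ 0 := by
    rintro rfl
    simp at ha0
  have h1' : a' * b = m * n := by linarith
  obtain ⟨g, h, ⟨k, rfl⟩, ⟨l, rfl⟩, rfl⟩ := exists_dvd_and_dvd_of_dvd_mul (Dvd.intro b h1')
  have hb : b = k * l := by
    apply mul_left_cancel₀ ha'0
    linarith
  subst hb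
  have hg0 : g ≠ 0 := left_ne_zero_of_mul ha'0
  have hh0 : h ≠ 0 := right_ne_zero_of_mul ha'0
  have hgl : IsCoprime g l := (hmn.of_mul_left_left).of_mul_right_right
  have hhk : IsCoprime h k := (hmn.of_mul_left_right).of_mul_right_left.symm
  have hko : k % 2 = 1 := by
    rcases Int.emod_two_eq_zero_or_one k with hb | hb
    · rw [Int.mul_emod, hb] at hbodd
      simp at hbodd
    · exact hb
  have hlo : l % 2 = 1 := by
    rcases Int.emod_two_eq_zero_or_one l with hb | hb
    · rw [Int.mul_emod, hb] at hbodd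
      simp at hbodd
    · exact hb
  have hl0 : l ≠ 0 := by
    rintro rfl
    simp at hlo
  have key : g ^ 2 * (16 * h ^ 2 - k ^ 2) = l ^ 2 * (k ^ 2 - h ^ 2) := by linear_combination h2
  obtain ⟨c, hc⟩ : l ^ 2 ∣ 16 * h ^ 2 - k ^ 2 :=
    (IsCoprime.pow hgl.symm).dvd_of_dvd_mul_left (Dvd.intro _ key.symm)
  have hc2 : k ^ 2 - h ^ 2 = c * g ^ 2 := by
    apply mul_left_cancel₀ (pow_ne_zero 2 hl0)
    rw [← key, hc]
    ring
  have e1 : 15 * h ^ 2 = c * (l ^ 2 + g ^ 2) := by linear_combination hc + hc2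
  have e2 : 15 * k ^ 2 = c * (l ^ 2 + 16 * g ^ 2) := by linear_combination hc + 16 * hc2
  have hcpos : 0 < c := by
    have : 0 < c * (l ^ 2 + g ^ 2) := by rw [← e1]; positivity
    by_contra hneg
    exact absurd this (not_lt.mpr (mul_nonpos_of_nonpos_of_nonneg (not_lt.mp hneg) (by positivity)))
  have hc15 : c ∣ 15 := by
    obtain ⟨u, v, huv⟩ := IsCoprime.pow (m := 2) (n := 2) hhk
    refine ⟨u * (l ^ 2 + g ^ 2) + v * (l ^ 2 + 16 * g ^ 2), ?_⟩
    linear_combination (-15) * huv + u * e1 + v * e2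
  have hc7 : c % 8 = 7 := by
    have hk8 : k ^ 2 % 8 = 1 := sq_mod_eight_odd hko
    have hl8 : l ^ 2 % 8 = 1 := sq_mod_eight_odd hlo
    obtain ⟨kk, hkk⟩ : ∃ kk, k ^ 2 = 8 * kk + 1 := ⟨k ^ 2 / 8, by omega⟩
    obtain ⟨ll, hll⟩ : ∃ ll, l ^ 2 = 8 * ll + 1 := ⟨l ^ 2 / 8, by omega⟩
    have : c = 8 * (2 * h ^ 2 - kk - ll * c) - 1 := by
      rw [hkk, hll] at hc
      linarith
    omega
  have hcle : c ≤ 15 := Int.le_of_dvd (by norm_num) hc15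
  have hceq : c = 15 := by
    have : c = 7 ∨ c = 15 := by omega
    rcases this with rfl | rfl
    · norm_num at hc15
    · rfl
  subst hceq
  have f1 : h ^ 2 = l ^ 2 + g ^ 2 := by linarith
  have f2 : k ^ 2 = l ^ 2 + 16 * g ^ 2 := by linarith
  have hk0 : k ≠ 0 := by
    rintro rfl
    simp at hko
  have t1 : PythagoreanTriple l g |h| := by
    unfold PythagoreanTriple
    rw [abs_mul_abs_self]; linarith
  have t2 : PythagoreanTriple l (4 * g) |k| := by
    unfold PythagoreanTriple
    rw [abs_mul_abs_self]; linarith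
  have h4l : IsCoprime (4 : ℤ) l := h4b.of_mul_right_right
  obtain ⟨m₁, n₁, p1, p2, -, p4, -, -⟩ := t1.coprime_classification'
    (Int.isCoprime_iff_gcd_eq_one.mp hgl.symm) hlo (abs_pos.mpr hh0)
  obtain ⟨M, N', q1, q2, -, q4, q5, -⟩ := t2.coprime_classification'
    (Int.isCoprime_iff_gcd_eq_one.mp (h4l.symm.mul_right hgl.symm)) hlo (abs_pos.mpr hk0)
  have hMN : M * N' = 2 * g := by linarith
  have hMN0 : M * N' ≠ 0 := by rw [hMN]; positivity
  have hlt : (M * N').natAbs < N := by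
    rw [← hN, hMN, Int.natAbs_mul, Int.natAbs_mul, Int.natAbs_mul]
    have : 0 < g.natAbs := Int.natAbs_pos.mpr hg0
    have : 0 < h.natAbs := Int.natAbs_pos.mpr hh0
    norm_num
    nlinarith
  have hM0 : M ≠ 0 := left_ne_zero_of_mul hMN0
  have hN0 : N' ≠ 0 := right_ne_zero_of_mul hMN0
  have hMle : M.natAbs ≤ (M * N').natAbs := by
    rw [Int.natAbs_mul]
    exact Nat.le_mul_of_pos_right _ (Int.natAbs_pos.mpr hN0)
  have hNle : N'.natAbs ≤ (M * N').natAbs := by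
    rw [Int.natAbs_mul]
    exact Nat.le_mul_of_pos_left _ (Int.natAbs_pos.mpr hM0)
  have cp1 : IsCoprime m₁ n₁ := Int.isCoprime_iff_gcd_eq_one.mpr p4
  have cp2 : IsCoprime M N' := Int.isCoprime_iff_gcd_eq_one.mpr q4
  rcases q5 with ⟨he, -⟩ | ⟨-, he⟩
  · exact hM0 (ih _ (lt_of_le_of_lt hMle hlt) M N' m₁ n₁ rfl he cp2 cp1 (by linarith) (by linarith))
  · exact hN0 (ih _ (lt_of_le_of_lt hNle hlt) N' M n₁ m₁ rfl he cp2.symm cp1.symm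
      (by linarith) (by linarith))

lemma odd_of_coprime_even {a b : ℤ} (ha : a % 2 = 0) (hab : IsCoprime a b) : b % 2 = 1 := by
  rcases Int.emod_two_eq_zero_or_one b with hb | hb
  · exfalso
    obtain ⟨u, v, huv⟩ := hab
    obtain ⟨a', rfl⟩ := Int.dvd_of_emod_eq_zero ha
    obtain ⟨b', rfl⟩ := Int.dvd_of_emod_eq_zero hb
    have : 2 * (u * a' + v * b') = 1 := by linarith
    omega
  · exact hb

lemma coprime_diff {a b : ℤ} (hab : IsCoprime a b) : IsCoprime (a ^ 2 - b ^ 2) (a * b) := by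
  refine IsCoprime.mul_right ?_ ?_
  · have h : IsCoprime (b ^ 2) a := hab.symm.pow_left
    have h' : IsCoprime (-b ^ 2) a := h.neg_left
    have e : a ^ 2 - b ^ 2 = -b ^ 2 + a * a := by ring
    rw [e]
    exact h'.add_mul_left_left a
  · have h : IsCoprime (a ^ 2) b := hab.pow_left
    have e : a ^ 2 - b ^ 2 = a ^ 2 + b * (-b) := by ring
    rw [e]
    exact h.add_mul_left_left (-b)

lemma quartic_even {a b c : ℤ} (ha : a % 2 = 0) (hab : IsCoprime a b)
    (h : 4 * a ^ 4 - 7 * a ^ 2 * b ^ 2 + 4 * b ^ 4 = c ^ 2) : a = 0 := by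
  have hb := odd_of_coprime_even ha hab
  obtain ⟨a', rfl⟩ := Int.dvd_of_emod_eq_zero ha
  have hc2 : (2 : ℤ) ∣ c := by
    refine Int.prime_two.dvd_of_dvd_pow (n := 2) ?_
    rw [← h]
    exact ⟨2 * (2 * a') ^ 4 - 14 * a' ^ 2 * b ^ 2 + 2 * b ^ 4, by ring⟩
  obtain ⟨c', rfl⟩ := hc2
  have hcop := coprime_diff hab
  have hcop' : IsCoprime ((2 * a') ^ 2 - b ^ 2) (a' * b) := by
    have : (2 * a') * b = 2 * (a' * b) := by ring
    rw [this] at hcop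
    exact hcop.of_mul_right_right
  have hodd : ((2 * a') ^ 2 - b ^ 2) % 2 = 1 := by
    have : b ^ 2 % 8 = 1 := sq_mod_eight_odd hb
    have h3 : (2 * a') ^ 2 = 4 * a' ^ 2 := by ring
    omega
  have hP : PythagoreanTriple ((2 * a') ^ 2 - b ^ 2) (a' * b) |c'| := by
    unfold PythagoreanTriple
    rw [abs_mul_abs_self]
    linarith
  have hc0 : c' ≠ 0 := by
    rintro rfl
    unfold PythagoreanTriple at hP
    simp only [abs_zero, mul_zero] at hP
    have : (2 * a') ^ 2 - b ^ 2 = 0 := by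
      nlinarith [mul_self_nonneg ((2 * a') ^ 2 - b ^ 2), mul_self_nonneg (a' * b)]
    rw [this] at hodd
    simp at hodd
  obtain ⟨m, n, p1, p2, -, p4, -, -⟩ := hP.coprime_classification'
    (Int.isCoprime_iff_gcd_eq_one.mp hcop') hodd (abs_pos.mpr hc0)
  exact descent _ (2 * a') b m n rfl ha hab (Int.isCoprime_iff_gcd_eq_one.mpr p4)
    (by linear_combination 2 * p2) p1

lemma quartic {a b c : ℤ} (hab : IsCoprime a b)
    (h : 4 * a ^ 4 - 7 * a ^ 2 * b ^ 2 + 4 * b ^ 4 = c ^ 2) : a = 0 ∨ b = 0 ∨ a ^ 2 = b ^ 2 := by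
  rcases Int.emod_two_eq_zero_or_one a with ha | ha
  · exact Or.inl (quartic_even ha hab h)
  rcases Int.emod_two_eq_zero_or_one b with hb | hb
  · exact Or.inr (Or.inl (quartic_even hb hab.symm (c := c) (by linarith)))
  right; right
  have hodd : (a * b) % 2 = 1 := by rw [Int.mul_emod, ha, hb]; rfl
  have h2 : IsCoprime (a * b) (2 : ℤ) := by
    refine ⟨1, -((a * b) / 2), ?_⟩
    omega
  have hcop : IsCoprime (a * b) (2 * (a ^ 2 - b ^ 2)) := h2.mul_right (coprime_diff hab).symm
  have hP : PythagoreanTriple (a * b) (2 * (a ^ 2 - b ^ 2)) |c| := by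
    unfold PythagoreanTriple
    rw [abs_mul_abs_self]
    linarith
  have hc0 : c ≠ 0 := by
    rintro rfl
    unfold PythagoreanTriple at hP
    simp only [abs_zero, mul_zero] at hP
    have : a * b = 0 := by
      nlinarith [mul_self_nonneg (2 * (a ^ 2 - b ^ 2)), mul_self_nonneg (a * b)]
    rw [this] at hodd
    simp at hodd
  obtain ⟨m, n, p1, p2, -, p4, p5, -⟩ := hP.coprime_classification'
    (Int.isCoprime_iff_gcd_eq_one.mp hcop) hodd (abs_pos.mpr hc0)
  have p2' : a ^ 2 - b ^ 2 = m * n := by linarith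
  have cp : IsCoprime m n := Int.isCoprime_iff_gcd_eq_one.mpr p4
  have hq : 4 * m ^ 4 - 7 * m ^ 2 * n ^ 2 + 4 * n ^ 4 = (a ^ 2 + b ^ 2) ^ 2 := by
    linear_combination (-4 * (a * b + (m ^ 2 - n ^ 2))) * p1 - (a ^ 2 - b ^ 2 + m * n) * p2'
  rcases p5 with ⟨he, -⟩ | ⟨-, he⟩
  · have := quartic_even he cp hq
    rw [this] at p2'
    linarith
  · have := quartic_even he cp.symm (c := a ^ 2 + b ^ 2) (by linarith)
    rw [this] at p2'
    linarith

lemma both_squares {p q c : ℤ} (hp : 0 < p) (hq : 0 < q) (hpq : IsCoprime p q)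
    (e : p * q = c ^ 2) : ∃ a b, p = a ^ 2 ∧ q = b ^ 2 := by
  obtain ⟨a, ha⟩ := pos_sq_of_coprime hp hpq e
  obtain ⟨b, hb⟩ := pos_sq_of_coprime hq hpq.symm (c := c) (by linarith)
  exact ⟨a, b, ha, hb⟩

lemma form_pos {p q : ℤ} (hp : 0 < p) (hq : 0 < q) : 0 < 4 * p ^ 2 - 7 * p * q + 4 * q ^ 2 := by
  nlinarith [sq_nonneg (p - q), mul_pos hp hq]

/-- `A p² + B p q + C q²` is coprime to `p q` when `p ⟂ C q` and `q ⟂ A p`. -/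
lemma coprime_form {p q : ℤ} (A B C : ℤ) (hpq : IsCoprime p q) (hp : IsCoprime p C)
    (hq : IsCoprime q A) : IsCoprime (p * q) (A * p ^ 2 + B * p * q + C * q ^ 2) := by
  refine IsCoprime.mul_left ?_ ?_
  · have h : IsCoprime p (C * q ^ 2) := hp.mul_right hpq.pow_right
    have e : A * p ^ 2 + B * p * q + C * q ^ 2 = C * q ^ 2 + p * (A * p + B * q) := by ring
    rw [e]
    exact h.add_mul_left_right (A * p + B * q)
  · have h : IsCoprime q (A * p ^ 2) := hq.mul_right hpq.symm.pow_right
    have e : A * p ^ 2 + B * p * q + C * q ^ 2 = A * p ^ 2 + q * (B * p + C * q) := by ring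
    rw [e]
    exact h.add_mul_left_right (B * p + C * q)

lemma coprime_two_of_odd {p : ℤ} (hp : p % 2 = 1) : IsCoprime p 2 :=
  ⟨1, -(p / 2), by omega⟩

lemma even_case {p q V : ℤ} (hp : 0 < p) (hq : 0 < q) (hpq : IsCoprime p q) (he : p % 2 = 0)
    (h : p * q * (4 * p ^ 2 - 7 * p * q + 4 * q ^ 2) = V ^ 2) : False := by
  have hqo := odd_of_coprime_even he hpq
  have hq2 := coprime_two_of_odd hqo
  obtain ⟨r, rfl⟩ := Int.dvd_of_emod_eq_zero he
  have hr : 0 < r := by linarith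
  have hrq : IsCoprime r q := hpq.of_mul_left_right
  have hV : (2 : ℤ) ∣ V := by
    refine Int.prime_two.dvd_of_dvd_pow (n := 2) ?_
    rw [← h]
    exact ⟨r * q * (4 * (2 * r) ^ 2 - 7 * (2 * r) * q + 4 * q ^ 2), by ring⟩
  obtain ⟨V, rfl⟩ := hV
  have h1 : r * q * (8 * r ^ 2 + (-7) * r * q + 2 * q ^ 2) = V ^ 2 := by linarith
  rcases Int.emod_two_eq_zero_or_one r with hre | hro
  · obtain ⟨s, rfl⟩ := Int.dvd_of_emod_eq_zero hre
    have hs : 0 < s := by linarith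
    have hsq : IsCoprime s q := hrq.of_mul_left_right
    have hV : (2 : ℤ) ∣ V := by
      refine Int.prime_two.dvd_of_dvd_pow (n := 2) ?_
      rw [← h1]
      exact ⟨s * q * (8 * (2 * s) ^ 2 + (-7) * (2 * s) * q + 2 * q ^ 2), by ring⟩
    obtain ⟨V, rfl⟩ := hV
    have h2 : s * q * (16 * s ^ 2 + (-7) * s * q + 1 * q ^ 2) = V ^ 2 := by linarith
    have hcop := coprime_form 16 (-7) 1 hsq isCoprime_one_right (by
      have := hq2.pow_right (n := 4)
      norm_num at this
      exact this)
    have hpos : 0 < 16 * s ^ 2 + (-7) * s * q + 1 * q ^ 2 := by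
      nlinarith [sq_nonneg (4 * s - q), mul_pos hs hq]
    obtain ⟨u, v, hu, hv⟩ := both_squares (mul_pos hs hq) hpos hcop h2
    obtain ⟨a, b, rfl, rfl⟩ := both_squares hs hq hsq hu
    have hab : IsCoprime (2 * a) b := by
      have h1 : IsCoprime a b := (IsCoprime.pow_iff (by norm_num) (by norm_num)).mp hsq
      have h2 : IsCoprime b 2 := (IsCoprime.pow_left_iff (by norm_num)).mp hq2
      exact h2.symm.mul_left h1
    have := quartic_even (c := 2 * v) (by omega) hab (by linear_combination 4 * hv)
    have ha : a = 0 := by linarith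
    rw [ha] at hs
    simp at hs
  · have hr2 := coprime_two_of_odd hro
    have hcop := coprime_form 8 (-7) 2 hrq hr2 (by
      have := hq2.pow_right (n := 3)
      norm_num at this
      exact this)
    have hpos : 0 < 8 * r ^ 2 + (-7) * r * q + 2 * q ^ 2 := by
      nlinarith [sq_nonneg (2 * r - q), mul_pos hr hq]
    obtain ⟨u, v, hu, hv⟩ := both_squares (mul_pos hr hq) hpos hcop h1
    obtain ⟨a, b, rfl, rfl⟩ := both_squares hr hq hrq hu
    have ha : a % 2 = 1 := by
      rcases Int.emod_two_eq_zero_or_one a with h | h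
      · rw [pow_two, Int.mul_emod, h] at hro
        simp at hro
      · exact h
    have hb : b % 2 = 1 := by
      rcases Int.emod_two_eq_zero_or_one b with h | h
      · rw [pow_two, Int.mul_emod, h] at hqo
        simp at hqo
      · exact h
    have ha8 : a ^ 2 % 8 = 1 := sq_mod_eight_odd ha
    have hb8 : b ^ 2 % 8 = 1 := sq_mod_eight_odd hb
    obtain ⟨A, hA⟩ : ∃ A, a ^ 2 = 8 * A + 1 := ⟨a ^ 2 / 8, by omega⟩
    obtain ⟨B, hB⟩ : ∃ B, b ^ 2 = 8 * B + 1 := ⟨b ^ 2 / 8, by omega⟩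
    rw [hA, hB] at hv
    have hv8 : v ^ 2 = 8 * (8 * (8 * A ^ 2 + 2 * A) + 1 - 7 * (8 * A * B + A + B) - 1
        + 2 * (8 * B ^ 2 + 2 * B)) + 3 := by linarith
    have hvm : v ^ 2 % 4 = 3 := by omega
    rcases Int.emod_two_eq_zero_or_one v with h | h
    · obtain ⟨w, rfl⟩ := Int.dvd_of_emod_eq_zero h
      have : (2 * w) ^ 2 = 4 * w ^ 2 := by ring
      omega
    · have : v ^ 2 % 8 = 1 := sq_mod_eight_odd h
      omega

lemma int_points {p q V : ℤ} (hp : 0 < p) (hq : 0 < q) (hpq : IsCoprime p q)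
    (h : p * q * (4 * p ^ 2 - 7 * p * q + 4 * q ^ 2) = V ^ 2) : p = q := by
  rcases Int.emod_two_eq_zero_or_one p with hpe | hpo
  · exact (even_case hp hq hpq hpe h).elim
  rcases Int.emod_two_eq_zero_or_one q with hqe | hqo
  · exact (even_case (V := V) hq hp hpq.symm hqe (by linarith)).elim
  have hp4 : IsCoprime p 4 := by
    have := (coprime_two_of_odd hpo).pow_right (n := 2)
    norm_num at this
    exact this
  have hq4 : IsCoprime q 4 := by
    have := (coprime_two_of_odd hqo).pow_right (n := 2)
    norm_num at this
    exact this
  have hcop := coprime_form 4 (-7) 4 hpq hp4 hq4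
  have hpos : 0 < 4 * p ^ 2 + (-7) * p * q + 4 * q ^ 2 := by linarith [form_pos hp hq]
  obtain ⟨u, v, hu, hv⟩ := both_squares (c := V) (mul_pos hp hq) hpos hcop (by linarith)
  obtain ⟨a, b, rfl, rfl⟩ := both_squares hp hq hpq hu
  have hab : IsCoprime a b := (IsCoprime.pow_iff (by norm_num) (by norm_num)).mp hpq
  rcases quartic (c := v) hab (by linarith) with rfl | rfl | h
  · simp at hp
  · simp at hq
  · exact h

/-- Rational points of the elliptic curve 15a8 in the form `W² = T(4T² - 7T + 4)`. -/
lemma elliptic_points {T W : ℚ} (h : W ^ 2 = T * (4 * T ^ 2 - 7 * T + 4)) : T = 0 ∨ T = 1 := by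
  by_cases hT : T = 0
  · exact Or.inl hT
  right
  have hTpos : 0 < T := by
    have hq : 0 < 4 * T ^ 2 - 7 * T + 4 := by nlinarith [sq_nonneg (8 * T - 7)]
    by_contra hneg
    have : T < 0 := lt_of_le_of_ne (not_lt.mp hneg) hT
    nlinarith [sq_nonneg W, mul_neg_of_neg_of_pos this hq]
  have hnum : 0 < T.num := Rat.num_pos.mpr hTpos
  have hden : (0 : ℤ) < T.den := by exact_mod_cast T.den_pos
  have hcop : IsCoprime T.num (T.den : ℤ) := by
    rw [Int.isCoprime_iff_gcd_eq_one]
    exact T.reduced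
  have hTe : T * (T.den : ℚ) = T.num := Rat.mul_den_eq_num T
  set p := T.num with hp
  set q : ℤ := (T.den : ℤ) with hq
  have hTe' : T * (q : ℚ) = (p : ℚ) := by
    rw [hq]
    exact_mod_cast hTe
  have hsq : (W * (q : ℚ) ^ 2) ^ 2 = ((p * q * (4 * p ^ 2 - 7 * p * q + 4 * q ^ 2) : ℤ) : ℚ) := by
    push_cast
    rw [← hTe']
    linear_combination (q : ℚ) ^ 4 * h
  have hint : ∃ V : ℤ, p * q * (4 * p ^ 2 - 7 * p * q + 4 * q ^ 2) = V ^ 2 := by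
    have : IsSquare ((p * q * (4 * p ^ 2 - 7 * p * q + 4 * q ^ 2) : ℤ) : ℚ) :=
      ⟨_, by rw [← hsq, pow_two]⟩
    rw [Rat.isSquare_intCast_iff] at this
    obtain ⟨V, hV⟩ := this
    exact ⟨V, by rw [hV, pow_two]⟩
  obtain ⟨V, hV⟩ := hint
  have := int_points hnum hden hcop hV
  rw [this] at hTe'
  have hq0 : (q : ℚ) ≠ 0 := by exact_mod_cast hden.ne'
  exact mul_right_cancel₀ hq0 (by rw [hTe', one_mul])

/-- A binary cubic form with odd values at the three nonzero points mod 2 has no rational zero. -/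
lemma cubic_no_root {A B : ℤ} (hAB : (A + B) % 2 = 1) {t : ℚ}
    (h : t ^ 3 + A * t ^ 2 + B * t + 1 = 0) : False := by
  have hTe : t * (t.den : ℚ) = t.num := Rat.mul_den_eq_num t
  have hcop : IsCoprime t.num (t.den : ℤ) := by
    rw [Int.isCoprime_iff_gcd_eq_one]
    exact t.reduced
  set p := t.num
  set q : ℤ := (t.den : ℤ) with hq
  have hTe' : t * (q : ℚ) = (p : ℚ) := by
    rw [hq]
    exact_mod_cast hTe
  have h1 : p ^ 3 + A * p ^ 2 * q + B * p * q ^ 2 + q ^ 3 = 0 := by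
    have : ((p ^ 3 + A * p ^ 2 * q + B * p * q ^ 2 + q ^ 3 : ℤ) : ℚ) = 0 := by
      push_cast
      rw [← hTe']
      linear_combination (q : ℚ) ^ 3 * h
    exact_mod_cast this
  have h2 := congrArg (fun n : ℤ => (n : ZMod 2)) h1
  have hA : ((A + B : ℤ) : ZMod 2) = 1 := by
    have : ((A + B - 1 : ℤ) : ZMod 2) = 0 := by
      rw [ZMod.intCast_zmod_eq_zero_iff_dvd]
      push_cast
      omega
    push_cast at this ⊢
    linear_combination this
  obtain ⟨u, v, huv⟩ := hcop
  have h3 := congrArg (fun n : ℤ => (n : ZMod 2)) huv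
  push_cast at h2 h3 hA
  generalize (p : ZMod 2) = p' at *
  generalize (q : ZMod 2) = q' at *
  generalize (u : ZMod 2) = u' at *
  generalize (v : ZMod 2) = v' at *
  generalize (A : ZMod 2) = A' at *
  generalize (B : ZMod 2) = B' at *
  revert h2 h3 hA
  clear * -
  revert p' q' u' v' A' B'
  decide


/-- If `x, y, z` are rational numbers, not all zero, with
`(x + y + z)·y³ = (x² − x·z + z²)·(x·z − y²)`, then `y = 0` and `x·z = 0`; equivalently,
the only rational points of the plane quartic
`C : (x + y + z)y³ = (x² − xz + z²)(xz − y²)` in `ℙ²_ℚ` are `(1 : 0 : 0)` and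
`(0 : 0 : 1)`. -/
theorem rational_points_15_90_3_c_1 (x y z : ℚ) (h : ¬(x = 0 ∧ y = 0 ∧ z = 0))
    (heq : (x + y + z) * y ^ 3 = (x ^ 2 - x * z + z ^ 2) * (x * z - y ^ 2)) :
    y = 0 ∧ x * z = 0 := by

  by_cases hx : x = 0
  · subst hx
    refine ⟨?_, by ring⟩
    have e : y ^ 2 * (y ^ 2 + y * z + z ^ 2) = 0 := by linear_combination heq
    rcases mul_eq_zero.mp e with e | e
    · exact pow_eq_zero_iff (two_ne_zero) |>.mp e
    · nlinarith [sq_nonneg (y + 2 * z), sq_nonneg y]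
  by_cases hz : z = 0
  · subst hz
    refine ⟨?_, by ring⟩
    have e : y ^ 2 * (y ^ 2 + y * x + x ^ 2) = 0 := by linear_combination heq
    rcases mul_eq_zero.mp e with e | e
    · exact pow_eq_zero_iff (two_ne_zero) |>.mp e
    · nlinarith [sq_nonneg (y + 2 * x), sq_nonneg y]
  exfalso
  have hD : z ^ 2 + z * y + y ^ 2 - x * z ≠ 0 := by
    intro hD
    have e : z ^ 2 * (y ^ 2 + y * z + z ^ 2) ^ 2 = 0 := by
      have hA : x * z = z ^ 2 + z * y + y ^ 2 := by linarith
      have h3 : (x * z + y * z + z ^ 2) * y ^ 3 * z =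
          ((x * z) ^ 2 - (x * z) * z ^ 2 + z ^ 4) * (x * z - y ^ 2) := by
        linear_combination z ^ 2 * heq
      rw [hA] at h3
      linear_combination -h3
    have hpos : 0 < y ^ 2 + y * z + z ^ 2 := by
      have : 0 < z ^ 2 := by positivity
      nlinarith [sq_nonneg (2 * y + z)]
    have : 0 < z ^ 2 * (y ^ 2 + y * z + z ^ 2) ^ 2 := by positivity
    linarith
  obtain ⟨D, hDe⟩ : ∃ D, D = z ^ 2 + z * y + y ^ 2 - x * z := ⟨_, rfl⟩
  rw [← hDe] at hD
  obtain ⟨N, hN⟩ : ∃ N, N = y ^ 2 * z + y ^ 3 - x * z ^ 2 + x * y ^ 2 + x ^ 2 * z + x ^ 2 * y :=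
    ⟨_, rfl⟩
  obtain ⟨X, hX⟩ : ∃ X, X = z * (x + y) / D := ⟨_, rfl⟩
  obtain ⟨Y, hY⟩ : ∃ Y, Y = N / (x * D) := ⟨_, rfl⟩
  have hX' : X * D = z * (x + y) := by rw [hX]; field_simp
  have hY' : Y * (x * D) = N := by rw [hY]; field_simp
  have hG : N ^ 2 * D + x * (z * (x + y)) * N * D + N * x * D ^ 2
      - x ^ 2 * (z * (x + y)) ^ 3 - x ^ 2 * (z * (x + y)) ^ 2 * D = 0 := by
    rw [hN, hDe]
    linear_combination ((x + y) * (y + z)) ^ 2 * heq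
  have hE : Y ^ 2 + X * Y + Y = X ^ 3 + X ^ 2 := by
    rw [← hX', ← hY'] at hG
    have hne : x ^ 2 * D ^ 3 ≠ 0 := by positivity
    apply mul_left_cancel₀ hne
    linear_combination hG
  have hW : (2 * Y + X + 1) ^ 2 = (X + 1) * (4 * (X + 1) ^ 2 - 7 * (X + 1) + 4) := by
    linear_combination 4 * hE
  rcases elliptic_points hW with h0 | h1
  · have hXv : X = -1 := by linarith
    have hyz : y = -z := by
      rw [hXv, hDe] at hX'
      have : (y + z) ^ 2 = 0 := by linear_combination -hX'
      have : y + z = 0 := pow_eq_zero_iff (two_ne_zero) |>.mp this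
      linarith
    subst hyz
    have e : z * (x ^ 3 - 2 * x ^ 2 * z + 3 * x * z ^ 2 - z ^ 3) = 0 := by
      linear_combination -heq
    have e' := (mul_eq_zero.mp e).resolve_left hz
    refine cubic_no_root (A := 2) (B := 3) (by norm_num) (t := -(x / z)) ?_
    push_cast
    field_simp
    linear_combination -e'
  · have hXv : X = 0 := by linarith
    have hxy : x = -y := by
      rw [hXv, zero_mul] at hX'
      have := (mul_eq_zero.mp hX'.symm).resolve_left hz
      linarith
    subst hxy
    have hy : y ≠ 0 := fun hy => hx (by rw [hy, neg_zero])
    have e : y * (y ^ 3 + 3 * y ^ 2 * z + 2 * y * z ^ 2 + z ^ 3) = 0 := by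
      linear_combination heq
    have e' := (mul_eq_zero.mp e).resolve_left hy
    refine cubic_no_root (A := 3) (B := 2) (by norm_num) (t := y / z) ?_
    push_cast
    field_simp
    linear_combination e'
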